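/- (Theorem 3: convergence of marginals.) For each n ∈ {1, …, P}, every initialization x_{1:n}^{(0)} ∈ S_1 × ⋯ × S_n and every measurable f_n: E_n → ℝ with |f_n| ≤ 1, lim_{i→∞} E[f_n(X_n^{(i)})] = π_n(f_n). -/

import Mathlib

open MeasureTheory
open scoped ENNReal

namespace Paper

noncomputable section

variable {E : Type*} [MeasurableSpace E]

/-- Metropolis–Hastings acceptance probability. -/
def acc {Z : Type*} (w : Z → ℝ≥0∞) (x x' : Z) : ℝ≥0∞ := min 1 (w x' / w x)

/-- The importance weight `w_{m+1}` on `E^{m+1}`. -/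
def wgt (γ : (n : ℕ) → (Fin n → E) → ℝ≥0∞) (q : (m : ℕ) → (Fin m → E) → E → ℝ≥0∞)
    (m : ℕ) (x : Fin (m + 1) → E) : ℝ≥0∞ :=
  γ (m + 1) x / (γ m (Fin.init x) * q m (Fin.init x) (x (Fin.last m)))

/-- The importance weight `w_1` on `E^1`. -/
def wgt1 (γ : (n : ℕ) → (Fin n → E) → ℝ≥0∞) (q1 : E → ℝ≥0∞) (x : Fin 1 → E) : ℝ≥0∞ :=
  γ 1 x / q1 (x 0)

/-- The proposal distribution `μ × q_{m+1}`, viewed as a measure on `E^{m+1}`. -/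
def propM (dx : Measure E) (q : (m : ℕ) → (Fin m → E) → E → ℝ≥0∞) (m : ℕ)
    (μ : Measure (Fin m → E)) : Measure (Fin (m + 1) → E) :=
  Measure.map (fun p : (Fin m → E) × E => Fin.snoc p.1 p.2)
    ((μ.prod dx).withDensity fun p => q m p.1 p.2)

/-- The proposal distribution at level 1, viewed as a measure on `E^1`. -/
def prop1 (dx : Measure E) (q1 : E → ℝ≥0∞) : Measure (Fin 1 → E) :=
  Measure.map (fun y : E => fun _ : Fin 1 => y) (dx.withDensity q1)

/-- The Metropolis–Hastings kernel `K_{m+1, μ}`. -/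
def kerM (dx : Measure E) (γ : (n : ℕ) → (Fin n → E) → ℝ≥0∞)
    (q : (m : ℕ) → (Fin m → E) → E → ℝ≥0∞) (m : ℕ) (μ : Measure (Fin m → E))
    (x : Fin (m + 1) → E) : Measure (Fin (m + 1) → E) :=
  (propM dx q m μ).withDensity (acc (wgt γ q m) x) +
    (1 - ∫⁻ y, acc (wgt γ q m) x y ∂(propM dx q m μ)) • Measure.dirac x

/-- The Metropolis–Hastings kernel `K_1`. -/
def ker1 (dx : Measure E) (γ : (n : ℕ) → (Fin n → E) → ℝ≥0∞) (q1 : E → ℝ≥0∞)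
    (x : Fin 1 → E) : Measure (Fin 1 → E) :=
  (prop1 dx q1).withDensity (acc (wgt1 γ q1) x) +
    (1 - ∫⁻ y, acc (wgt1 γ q1) x y ∂(prop1 dx q1)) • Measure.dirac x

/-- The target distribution `π_n` on `E^n`. -/
def tgt (dx : Measure E) [SigmaFinite dx] (γ : (n : ℕ) → (Fin n → E) → ℝ≥0∞)
    (Z : ℕ → ℝ≥0∞) (n : ℕ) : Measure (Fin n → E) :=
  (Measure.pi fun _ : Fin n => dx).withDensity fun x => γ n x / Z n

/-- The marginal density `π_{m+1}(x_m)`. -/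
def marg (dx : Measure E) (γ : (n : ℕ) → (Fin n → E) → ℝ≥0∞) (Z : ℕ → ℝ≥0∞) (m : ℕ)
    (x : Fin m → E) : ℝ≥0∞ :=
  (∫⁻ y, γ (m + 1) (Fin.snoc x y) ∂dx) / Z (m + 1)

/-- The ratio `π_{(m+1)/m}(x_m) = π_{m+1}(x_m)/π_m(x_m)`. -/
def ratio (dx : Measure E) (γ : (n : ℕ) → (Fin n → E) → ℝ≥0∞) (Z : ℕ → ℝ≥0∞) (m : ℕ)
    (x : Fin m → E) : ℝ≥0∞ :=
  marg dx γ Z m x / (γ m x / Z m)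

/-- The invariant distribution `ω_{m+1}(μ)`. -/
def omegaM (dx : Measure E) (γ : (n : ℕ) → (Fin n → E) → ℝ≥0∞) (Z : ℕ → ℝ≥0∞) (m : ℕ)
    (μ : Measure (Fin m → E)) : Measure (Fin (m + 1) → E) :=
  (∫⁻ x, ratio dx γ Z m x ∂μ)⁻¹ •
    Measure.map (fun p : (Fin m → E) × E => Fin.snoc p.1 p.2)
      ((μ.prod dx).withDensity fun p =>
        ratio dx γ Z m p.1 *
          ((γ (m + 1) (Fin.snoc p.1 p.2) / Z (m + 1)) / marg dx γ Z m p.1))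

/-- The empirical measure `π̂_n^{(i)}(ω)`. -/
def emp {Ω : Type*} (X : (n : ℕ) → ℕ → Ω → (Fin n → E)) (n i : ℕ) (ω : Ω) :
    Measure (Fin n → E) :=
  ((i : ℝ≥0∞) + 1)⁻¹ • ∑ k ∈ Finset.range (i + 1), Measure.dirac (X n k ω)

/-- The σ-algebra generated by the variables generated strictly before `X_n^{(i)}`
in the order `X_1^{(1)}, …, X_P^{(1)}, X_1^{(2)}, …` (the variables `X_k^{(0)}`
being given at initialization). -/
def past {Ω : Type*} (P : ℕ) (X : (n : ℕ) → ℕ → Ω → (Fin n → E)) (n i : ℕ) :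
    MeasurableSpace Ω :=
  ⨆ (k : ℕ) (j : ℕ) (_ : (1 ≤ k ∧ k ≤ P ∧ j < i) ∨ (1 ≤ k ∧ k < n ∧ j = i)),
    MeasurableSpace.comap (X k j) inferInstance

section IndependentMetropolis

variable {S : Type*}

/-- The acceptance probability of a proposal `y` from a state of weight `t`, in real form. -/
def accR (w : S → ℝ) (t : ℝ) (y : S) : ℝ := w y / max t (w y)

lemma accR_nonneg {w : S → ℝ} (hw : ∀ x, 0 ≤ w x) (t : ℝ) (y : S) : 0 ≤ accR w t y :=
  div_nonneg (hw y) (le_max_of_le_right (hw y))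

lemma accR_le_one {w : S → ℝ} (hw : ∀ x, 0 ≤ w x) (t : ℝ) (y : S) : accR w t y ≤ 1 :=
  div_le_one_of_le₀ (le_max_right _ _) (le_max_of_le_right (hw y))

lemma accR_antitone {w : S → ℝ} (hw : ∀ x, 0 ≤ w x) (y : S) : Antitone fun t => accR w t y := by
  intro s t hst
  rcases (hw y).eq_or_lt with h | h
  · simp [accR, ← h]
  · exact div_le_div_of_nonneg_left h.le (lt_max_of_lt_right h) (max_le_max_right _ hst)

lemma accR_continuous {w : S → ℝ} (hw : ∀ x, 0 ≤ w x) (y : S) :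
    Continuous fun t => accR w t y := by
  rcases (hw y).eq_or_lt with h | h
  · simpa [accR, ← h] using continuous_const
  · exact continuous_const.div (continuous_id.max continuous_const)
      fun t => (lt_max_of_lt_right h).ne'

lemma abs_accR_mul_le {w : S → ℝ} (hw : ∀ x, 0 ≤ w x) {g : S → ℝ} {C : ℝ}
    (hg : ∀ x, |g x| ≤ C) (t : ℝ) (y : S) : |accR w t y * g y| ≤ C := by
  rw [abs_mul, abs_of_nonneg (accR_nonneg hw t y)]
  calc accR w t y * |g y| ≤ 1 * |g y| :=
        mul_le_mul_of_nonneg_right (accR_le_one hw t y) (abs_nonneg _)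
    _ ≤ C := by simpa using hg y

variable [MeasurableSpace S]

/-- The action on functions of the independent Metropolis–Hastings kernel with proposal `Q` and
importance weight `w`. -/
def mhOp (Q : Measure S) (w : S → ℝ) (g : S → ℝ) (x : S) : ℝ :=
  (∫ y, accR w (w x) y * g y ∂Q) + (1 - ∫ y, accR w (w x) y ∂Q) * g x

lemma measurable_accR {w : S → ℝ} (hwm : Measurable w) :
    Measurable fun p : ℝ × S => accR w p.1 p.2 :=
  (hwm.comp measurable_snd).div (measurable_fst.max (hwm.comp measurable_snd))

lemma measurable_accR_right {w : S → ℝ} (hwm : Measurable w) (t : ℝ) :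
    Measurable (accR w t) :=
  (measurable_accR hwm).comp measurable_prodMk_left

lemma integrable_of_abs_le {α : Type*} {mα : MeasurableSpace α} {ν : Measure α}
    [IsFiniteMeasure ν] {g : α → ℝ} (hg : Measurable g) {C : ℝ} (hC : ∀ x, |g x| ≤ C) :
    Integrable g ν :=
  Integrable.of_bound hg.aestronglyMeasurable C (ae_of_all _ hC)

lemma integrable_accR_mul {Q : Measure S} [IsFiniteMeasure Q] {w : S → ℝ} (hwm : Measurable w)
    (hw : ∀ x, 0 ≤ w x) {g : S → ℝ} (hgm : Measurable g) {C : ℝ} (hg : ∀ x, |g x| ≤ C) (t : ℝ) :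
    Integrable (fun y => accR w t y * g y) Q :=
  integrable_of_abs_le ((measurable_accR_right hwm t).mul hgm) (abs_accR_mul_le hw hg t)

lemma integrable_accR {Q : Measure S} [IsFiniteMeasure Q] {w : S → ℝ} (hwm : Measurable w)
    (hw : ∀ x, 0 ≤ w x) (t : ℝ) : Integrable (accR w t) Q := by
  simpa using integrable_accR_mul (Q := Q) hwm hw (g := fun _ => 1) measurable_const
    (C := 1) (by simp) t

lemma integral_accR_nonneg {Q : Measure S} {w : S → ℝ} (hw : ∀ x, 0 ≤ w x) (t : ℝ) :
    0 ≤ ∫ y, accR w t y ∂Q :=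
  integral_nonneg (accR_nonneg hw t)

lemma integral_accR_le_one {Q : Measure S} [IsProbabilityMeasure Q] {w : S → ℝ}
    (hwm : Measurable w) (hw : ∀ x, 0 ≤ w x) (t : ℝ) : ∫ y, accR w t y ∂Q ≤ 1 := by
  simpa using integral_mono (integrable_accR (Q := Q) hwm hw t) (integrable_const (1 : ℝ))
    (accR_le_one hw t)

lemma measurable_mhOp {Q : Measure S} [SFinite Q] {w : S → ℝ} (hwm : Measurable w)
    {g : S → ℝ} (hgm : Measurable g) : Measurable (mhOp Q w g) := by
  have h1 : Measurable fun p : S × S => accR w (w p.1) p.2 :=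
    (measurable_accR hwm).comp ((hwm.comp measurable_fst).prodMk measurable_snd)
  have h2 : Measurable fun x => ∫ y, accR w (w x) y ∂Q :=
    (StronglyMeasurable.integral_prod_right (f := fun x y => accR w (w x) y)
      h1.stronglyMeasurable).measurable
  have h3 : Measurable fun x => ∫ y, accR w (w x) y * g y ∂Q :=
    (StronglyMeasurable.integral_prod_right (f := fun x y => accR w (w x) y * g y)
      (h1.mul (hgm.comp measurable_snd)).stronglyMeasurable).measurable
  exact h3.add ((measurable_const.sub h2).mul hgm)

lemma abs_mhOp_le {Q : Measure S} [IsProbabilityMeasure Q] {w : S → ℝ} (hwm : Measurable w)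
    (hw : ∀ x, 0 ≤ w x) {g : S → ℝ} {C : ℝ} (hg : ∀ x, |g x| ≤ C) (x : S) :
    |mhOp Q w g x| ≤ C := by
  have h1 : |∫ y, accR w (w x) y * g y ∂Q| ≤ ∫ y, accR w (w x) y * C ∂Q := by
    rw [← Real.norm_eq_abs]
    refine norm_integral_le_of_norm_le ((integrable_accR (Q := Q) hwm hw _).mul_const C)
      (ae_of_all _ fun y => ?_)
    rw [Real.norm_eq_abs, abs_mul, abs_of_nonneg (accR_nonneg hw _ y)]
    exact mul_le_mul_of_nonneg_left (hg y) (accR_nonneg hw _ y)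
  rw [integral_mul_const] at h1
  have h2 := integral_accR_le_one (Q := Q) hwm hw (w x)
  have h3 : |(1 - ∫ y, accR w (w x) y ∂Q) * g x| ≤ (1 - ∫ y, accR w (w x) y ∂Q) * C := by
    rw [abs_mul, abs_of_nonneg (by linarith)]
    exact mul_le_mul_of_nonneg_left (hg x) (by linarith)
  calc |mhOp Q w g x| ≤ _ := abs_add_le _ _
    _ ≤ C := by linarith

/-- Reversibility gives invariance of the reweighted proposal. -/
lemma integral_weight_mul_mhOp {Q : Measure S} [IsProbabilityMeasure Q] {w : S → ℝ}
    (hwm : Measurable w) (hw : ∀ x, 0 ≤ w x) {b : ℝ} (hwb : ∀ x, w x ≤ b) {g : S → ℝ}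
    (hgm : Measurable g) {C : ℝ} (hg : ∀ x, |g x| ≤ C) :
    ∫ x, w x * mhOp Q w g x ∂Q = ∫ x, w x * g x ∂Q := by
  have hsymm : ∀ x y, w x * accR w (w x) y = w y * accR w (w y) x := by
    intro x y
    simp only [accR, max_comm (w y) (w x)]
    ring
  have h1 : Measurable fun p : S × S => accR w (w p.1) p.2 :=
    (measurable_accR hwm).comp ((hwm.comp measurable_fst).prodMk measurable_snd)
  have hint : Integrable (Function.uncurry fun x y => w x * accR w (w x) y * g y) (Q.prod Q) := by
    refine integrable_of_abs_le (((hwm.comp measurable_fst).mul h1).mul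
      (hgm.comp measurable_snd)) (C := b * C) ?_
    rintro ⟨x, y⟩
    simp only [Function.uncurry, mul_assoc]
    rw [abs_mul, abs_of_nonneg (hw x)]
    exact mul_le_mul (hwb x) (abs_accR_mul_le hw hg _ y) (abs_nonneg _) ((hw x).trans (hwb x))
  have hswap := integral_integral_swap hint
  have e1 : ∀ x, ∫ y, w y * accR w (w y) x * g x ∂Q
      = w x * g x * ∫ y, accR w (w x) y ∂Q := by
    intro x
    rw [← integral_const_mul]
    refine integral_congr_ae (ae_of_all _ fun y => ?_)
    simp only [hsymm y x]
    ring
  simp only [e1] at hswap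
  have hm2 : Measurable fun x => ∫ y, accR w (w x) y ∂Q :=
    (StronglyMeasurable.integral_prod_right (f := fun x y => accR w (w x) y)
      h1.stronglyMeasurable).measurable
  have hwg : Integrable (fun x => w x * g x) Q := by
    refine integrable_of_abs_le (hwm.mul hgm) (C := b * C) fun x => ?_
    rw [abs_mul, abs_of_nonneg (hw x)]
    exact mul_le_mul (hwb x) (hg x) (abs_nonneg _) ((hw x).trans (hwb x))
  have hwgA : Integrable (fun x => w x * g x * ∫ y, accR w (w x) y ∂Q) Q := by
    refine integrable_of_abs_le ((hwm.mul hgm).mul hm2) (C := b * C) fun x => ?_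
    rw [abs_mul, abs_mul, abs_of_nonneg (hw x), abs_of_nonneg (integral_accR_nonneg hw _)]
    calc w x * |g x| * ∫ y, accR w (w x) y ∂Q ≤ w x * |g x| * 1 :=
          mul_le_mul_of_nonneg_left (integral_accR_le_one hwm hw _)
            (mul_nonneg (hw x) (abs_nonneg _))
      _ ≤ b * C := by
          rw [mul_one]
          exact mul_le_mul (hwb x) (hg x) (abs_nonneg _) ((hw x).trans (hwb x))
  have hI := hint.integral_prod_left
  simp only [Function.uncurry] at hI
  have hD : Integrable (fun x => w x * g x - w x * g x * ∫ y, accR w (w x) y ∂Q) Q :=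
    hwg.sub hwgA
  calc ∫ x, w x * mhOp Q w g x ∂Q
      = ∫ x, ((∫ y, w x * accR w (w x) y * g y ∂Q)
          + (w x * g x - w x * g x * ∫ y, accR w (w x) y ∂Q)) ∂Q := by
        refine integral_congr_ae (ae_of_all _ fun x => ?_)
        simp only [mhOp, mul_assoc]
        rw [integral_const_mul]
        ring
    _ = (∫ x, ∫ y, w x * accR w (w x) y * g y ∂Q ∂Q)
          + (∫ x, w x * g x ∂Q - ∫ x, w x * g x * ∫ y, accR w (w x) y ∂Q ∂Q) := by
        rw [integral_add hI hD, integral_sub hwg hwgA]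
    _ = _ := by rw [hswap]; ring

/-- A boundedness condition on the weight makes the independent sampler a contraction. -/
lemma abs_mhOp_sub_le {Q : Measure S} [IsProbabilityMeasure Q] {w : S → ℝ}
    (hwm : Measurable w) (hw : ∀ x, 0 ≤ w x) {b : ℝ} (hb : 0 < b) (hwb : ∀ x, w x ≤ b)
    {g : S → ℝ} (hgm : Measurable g) {a r : ℝ} (hg : ∀ x, |g x - a| ≤ r)
    (hga : ∫ x, w x * g x ∂Q = a * ∫ x, w x ∂Q) (x : S) :
    |mhOp Q w g x - a| ≤ (1 - (∫ y, w y ∂Q) / b) * r := by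
  have hr : 0 ≤ r := (abs_nonneg _).trans (hg x)
  have hgC : ∀ y, |g y| ≤ r + |a| := fun y => by
    have := abs_add_le (g y - a) a
    rw [sub_add_cancel] at this
    linarith [hg y]
  set A := ∫ y, accR w (w x) y ∂Q with hA
  have hA1 : A ≤ 1 := integral_accR_le_one hwm hw _
  have iw : Integrable w Q := integrable_of_abs_le hwm (C := b) fun y => by
    rw [abs_of_nonneg (hw y)]; exact hwb y
  have iwg : Integrable (fun y => w y * g y) Q := by
    refine integrable_of_abs_le (hwm.mul hgm) (C := b * (r + |a|)) fun y => ?_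
    rw [abs_mul, abs_of_nonneg (hw y)]
    exact mul_le_mul (hwb y) (hgC y) (abs_nonneg _) hb.le
  have ia := integrable_accR (Q := Q) hwm hw (w x)
  have iag := integrable_accR_mul (Q := Q) hwm hw hgm hgC (w x)
  have i1 : Integrable (fun y => accR w (w x) y * g y - accR w (w x) y * a) Q :=
    iag.sub (ia.mul_const _)
  have i2 : Integrable (fun y => w y * g y / b - w y * (a / b)) Q :=
    (iwg.div_const _).sub (iw.mul_const _)
  have i3 : Integrable (fun y => accR w (w x) y - w y / b) Q := ia.sub (iw.div_const _)
  have hle : ∀ y, w y / b ≤ accR w (w x) y := by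
    intro y
    rcases (hw y).eq_or_lt with h | h
    · simp [accR, ← h]
    · exact div_le_div_of_nonneg_left h.le (lt_max_of_lt_right h) (max_le (hwb x) (hwb y))
  have key : ∫ y, (accR w (w x) y - w y / b) * (g y - a) ∂Q
      = (∫ y, accR w (w x) y * g y ∂Q) - a * A := by
    have : ∀ y, (accR w (w x) y - w y / b) * (g y - a)
        = (accR w (w x) y * g y - accR w (w x) y * a) - (w y * g y / b - w y * (a / b)) :=
      fun y => by ring
    simp only [this]
    rw [integral_sub i1 i2,
      integral_sub iag (ia.mul_const _), integral_sub (iwg.div_const _) (iw.mul_const _),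
      integral_mul_const, integral_mul_const, integral_div, hga]
    ring
  have hbd : |∫ y, (accR w (w x) y - w y / b) * (g y - a) ∂Q|
      ≤ (A - (∫ y, w y ∂Q) / b) * r := by
    have : ∫ y, (accR w (w x) y - w y / b) * r ∂Q = (A - (∫ y, w y ∂Q) / b) * r := by
      rw [integral_mul_const, integral_sub ia (iw.div_const _), integral_div]
    rw [← this, ← Real.norm_eq_abs]
    refine norm_integral_le_of_norm_le (i3.mul_const r)
      (ae_of_all _ fun y => ?_)
    rw [Real.norm_eq_abs, abs_mul, abs_of_nonneg (sub_nonneg.2 (hle y))]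
    exact mul_le_mul_of_nonneg_left (hg y) (sub_nonneg.2 (hle y))
  have e : mhOp Q w g x - a
      = (∫ y, (accR w (w x) y - w y / b) * (g y - a) ∂Q) + (1 - A) * (g x - a) := by
    rw [key, mhOp]; ring
  have h2 : |(1 - A) * (g x - a)| ≤ (1 - A) * r := by
    rw [abs_mul, abs_of_nonneg (by linarith)]
    exact mul_le_mul_of_nonneg_left (hg x) (by linarith)
  rw [e]
  refine (abs_add_le _ _).trans ?_
  linarith

lemma measurable_iterate_mhOp {Q : Measure S} [SFinite Q] {w : S → ℝ} (hwm : Measurable w)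
    (N : ℕ) {g : S → ℝ} (hgm : Measurable g) : Measurable ((mhOp Q w)^[N] g) := by
  induction N generalizing g with
  | zero => exact hgm
  | succ N ih => exact ih (measurable_mhOp hwm hgm)

/-- Uniform geometric ergodicity of the independent Metropolis–Hastings sampler. -/
lemma abs_iterate_mhOp_sub_le {Q : Measure S} [IsProbabilityMeasure Q] {w : S → ℝ}
    (hwm : Measurable w) (hw : ∀ x, 0 ≤ w x) {b : ℝ} (hb : 0 < b) (hwb : ∀ x, w x ≤ b)
    (N : ℕ) {g : S → ℝ} (hgm : Measurable g) {a r : ℝ} (hg : ∀ x, |g x - a| ≤ r)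
    (hga : ∫ x, w x * g x ∂Q = a * ∫ x, w x ∂Q) (x : S) :
    |(mhOp Q w)^[N] g x - a| ≤ (1 - (∫ y, w y ∂Q) / b) ^ N * r := by
  induction N generalizing g r with
  | zero => simpa using hg x
  | succ N ih =>
    have hgC : ∀ y, |g y| ≤ r + |a| := fun y => by
      have := abs_add_le (g y - a) a
      rw [sub_add_cancel] at this
      linarith [hg y]
    rw [Function.iterate_succ_apply, pow_succ, mul_assoc]
    refine ih (measurable_mhOp hwm hgm) (abs_mhOp_sub_le hwm hw hb hwb hgm hg hga) ?_
    rw [integral_weight_mul_mhOp hwm hw hwb hgm hgC, hga]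

end IndependentMetropolis

section UniformComparison

variable {S : Type*} [MeasurableSpace S]

lemma exists_finset_accR_of_nonneg (Q : Measure S) [IsProbabilityMeasure Q] {w : S → ℝ}
    (hwm : Measurable w) (hw : ∀ x, 0 ≤ w x) (b : ℝ) {g : S → ℝ} (hgm : Measurable g)
    (hg0 : ∀ x, 0 ≤ g x) {C : ℝ} (hg : ∀ x, g x ≤ C) {ε : ℝ} (hε : 0 < ε) :
    ∃ T : Finset ℝ, ∀ Q' : Measure S, IsProbabilityMeasure Q' → ∀ t, 0 ≤ t → t ≤ b →
      |∫ y, accR w t y * g y ∂Q' - ∫ y, accR w t y * g y ∂Q|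
        ≤ ε + ∑ s ∈ T, |∫ y, accR w s y * g y ∂Q' - ∫ y, accR w s y * g y ∂Q| := by
  classical
  have hgC : ∀ x, |g x| ≤ C := fun x => by rw [abs_of_nonneg (hg0 x)]; exact hg x
  have hcont : Continuous fun t => ∫ y, accR w t y * g y ∂Q :=
    continuous_of_dominated
      (fun t => ((measurable_accR_right hwm t).mul hgm).aestronglyMeasurable)
      (fun t => ae_of_all _ (abs_accR_mul_le hw hgC t)) (integrable_const C)
      (ae_of_all _ fun y => (accR_continuous hw y).mul continuous_const)
  have hanti : ∀ Q' : Measure S, IsProbabilityMeasure Q' →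
      Antitone fun t => ∫ y, accR w t y * g y ∂Q' := fun Q' _ s t hst =>
    integral_mono (integrable_accR_mul hwm hw hgm hgC t) (integrable_accR_mul hwm hw hgm hgC s)
      fun y => mul_le_mul_of_nonneg_right (accR_antitone hw y hst) (hg0 y)
  have hloc : ∀ t : ℝ, ∃ δ > 0, ∀ s, |s - t| ≤ δ →
      |∫ y, accR w s y * g y ∂Q - ∫ y, accR w t y * g y ∂Q| < ε / 2 := by
    intro t
    obtain ⟨δ, hδ, h⟩ := Metric.continuousAt_iff.1 (hcont.continuousAt (x := t)) (ε / 2)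
      (half_pos hε)
    refine ⟨δ / 2, half_pos hδ, fun s hs => ?_⟩
    have := h (x := s) (by rw [Real.dist_eq]; linarith)
    rwa [Real.dist_eq] at this
  choose δ hδ hδ' using hloc
  obtain ⟨T, -, hT⟩ := (isCompact_Icc (a := (0 : ℝ)) (b := b)).elim_nhds_subcover
    (fun t => Metric.ball t (δ t)) fun t _ => Metric.ball_mem_nhds t (hδ t)
  refine ⟨T.image (fun t => t - δ t) ∪ T.image (fun t => t + δ t), fun Q' hQ' t h0 hb => ?_⟩
  obtain ⟨s, hs, hst⟩ := Set.mem_iUnion₂.1 (hT ⟨h0, hb⟩)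
  rw [Metric.mem_ball, Real.dist_eq, abs_lt] at hst
  have hmem : ∀ u ∈ T.image (fun t => t - δ t) ∪ T.image (fun t => t + δ t),
      |∫ y, accR w u y * g y ∂Q' - ∫ y, accR w u y * g y ∂Q| ≤
      ∑ s ∈ T.image (fun t => t - δ t) ∪ T.image (fun t => t + δ t),
        |∫ y, accR w s y * g y ∂Q' - ∫ y, accR w s y * g y ∂Q| := fun u hu =>
    Finset.single_le_sum
      (f := fun s => |∫ y, accR w s y * g y ∂Q' - ∫ y, accR w s y * g y ∂Q|)
      (fun _ _ => abs_nonneg _) hu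
  have m1 := abs_le.1 (hmem (s - δ s)
    (Finset.mem_union_left _ (Finset.mem_image_of_mem (fun t => t - δ t) hs)))
  have m2 := abs_le.1 (hmem (s + δ s)
    (Finset.mem_union_right _ (Finset.mem_image_of_mem (fun t => t + δ t) hs)))
  have c1 := abs_lt.1 (hδ' s (s - δ s) (by simp [abs_of_pos (hδ s)]))
  have c2 := abs_lt.1 (hδ' s (s + δ s) (by simp [abs_of_pos (hδ s)]))
  have a1 := hanti Q' hQ' (show s - δ s ≤ t by linarith)
  have a2 := hanti Q' hQ' (show t ≤ s + δ s by linarith)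
  have a3 := hanti Q ‹_› (show s - δ s ≤ t by linarith)
  have a4 := hanti Q ‹_› (show t ≤ s + δ s by linarith)
  simp only at a1 a2 a3 a4
  rw [abs_le]
  constructor <;> linarith

/-- The operators `mhOp Q' w` and `mhOp Q w` are uniformly close on a bounded function as soon as
`Q'` and `Q` are close on finitely many bounded functions. -/
lemma exists_testFunctions_mhOp (Q : Measure S) [IsProbabilityMeasure Q] {w : S → ℝ}
    (hwm : Measurable w) (hw : ∀ x, 0 ≤ w x) {b : ℝ} (hwb : ∀ x, w x ≤ b) {g : S → ℝ}
    (hgm : Measurable g) (hg : ∀ x, |g x| ≤ 1) {ε : ℝ} (hε : 0 < ε) :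
    ∃ (T : Finset ℝ) (φ ψ : ℝ → S → ℝ),
      (∀ s, Measurable (φ s) ∧ ∀ x, |φ s x| ≤ 1) ∧ (∀ s, Measurable (ψ s) ∧ ∀ x, |ψ s x| ≤ 1) ∧
      ∀ Q' : Measure S, IsProbabilityMeasure Q' → ∀ x, |mhOp Q' w g x - mhOp Q w g x|
        ≤ ε + 2 * ∑ s ∈ T, (|∫ y, φ s y ∂Q' - ∫ y, φ s y ∂Q| +
            |∫ y, ψ s y ∂Q' - ∫ y, ψ s y ∂Q|) := by
  classical
  set h : S → ℝ := fun x => (g x + 1) / 2 with hh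
  have hhm : Measurable h := (hgm.add_const 1).div_const 2
  have hh0 : ∀ x, 0 ≤ h x := fun x => by have := abs_le.1 (hg x); simp only [hh]; linarith
  have hh1 : ∀ x, h x ≤ 1 := fun x => by have := abs_le.1 (hg x); simp only [hh]; linarith
  have hha : ∀ x, |h x| ≤ 1 := fun x => by rw [abs_of_nonneg (hh0 x)]; exact hh1 x
  obtain ⟨T₁, hT₁⟩ := exists_finset_accR_of_nonneg Q hwm hw b hhm hh0 hh1
    (show 0 < ε / 4 by linarith)
  obtain ⟨T₂, hT₂⟩ := exists_finset_accR_of_nonneg Q hwm hw b (g := fun _ => 1)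
    measurable_const (fun _ => zero_le_one) (fun _ => le_rfl) (show 0 < ε / 4 by linarith)
  simp only [mul_one] at hT₂
  refine ⟨T₁ ∪ T₂, fun s y => accR w s y * h y, fun s y => accR w s y,
    fun s => ⟨(measurable_accR_right hwm s).mul hhm, abs_accR_mul_le hw hha s⟩,
    fun s => ⟨measurable_accR_right hwm s, fun y => ?_⟩, fun Q' hQ' x => ?_⟩
  · rw [abs_of_nonneg (accR_nonneg hw s y)]
    exact accR_le_one hw s y
  have b1 := (hT₁ Q' hQ' (w x) (hw x) (hwb x)).trans (add_le_add_right
    (Finset.sum_le_sum_of_subset_of_nonneg (Finset.subset_union_left (s₂ := T₂))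
      fun _ _ _ => abs_nonneg _) _)
  have b2 := (hT₂ Q' hQ' (w x) (hw x) (hwb x)).trans (add_le_add_right
    (Finset.sum_le_sum_of_subset_of_nonneg (Finset.subset_union_right (s₁ := T₁))
      fun _ _ _ => abs_nonneg _) _)
  have hsplit : ∀ ν : Measure S, IsProbabilityMeasure ν → mhOp ν w g x
      = 2 * (∫ y, accR w (w x) y * h y ∂ν) - (∫ y, accR w (w x) y ∂ν) * (1 + g x) + g x := by
    intro ν _
    have : ∫ y, accR w (w x) y * g y ∂ν
        = 2 * (∫ y, accR w (w x) y * h y ∂ν) - ∫ y, accR w (w x) y ∂ν := by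
      rw [← integral_const_mul, ← integral_sub
        ((integrable_accR_mul hwm hw hhm hha (w x)).const_mul 2) (integrable_accR hwm hw (w x))]
      refine integral_congr_ae (ae_of_all _ fun y => ?_)
      simp only [hh]
      ring
    rw [mhOp, this]
    ring
  rw [hsplit Q' hQ', hsplit Q ‹_›, Finset.sum_add_distrib]
  set D₁ := ∫ y, accR w (w x) y * h y ∂Q' - ∫ y, accR w (w x) y * h y ∂Q
  set D₂ := ∫ y, accR w (w x) y ∂Q' - ∫ y, accR w (w x) y ∂Q
  have hgx : |1 + g x| ≤ 2 := (abs_add_le _ _).trans (by rw [abs_one]; linarith [hg x])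
  calc _ = |2 * D₁ - D₂ * (1 + g x)| := by
        congr 1
        simp only [D₁, D₂]
        ring
    _ ≤ 2 * |D₁| + |D₂| * 2 := by
        refine (abs_sub _ _).trans ?_
        rw [abs_mul, abs_mul, abs_two]
        exact add_le_add_right (mul_le_mul_of_nonneg_left hgx (abs_nonneg _)) _
    _ ≤ _ := by linarith

/-- The independent Metropolis–Hastings kernel acts on bounded functions as `mhOp`. -/
lemma integral_mhKernel {Q : Measure S} [IsProbabilityMeasure Q] {W : S → ℝ≥0∞}
    (hWm : Measurable W) (hWt : ∀ x, W x ≠ ⊤) {g : S → ℝ} (hgm : Measurable g) {C : ℝ}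
    (hg : ∀ x, |g x| ≤ C) (x : S) :
    ∫ z, g z ∂(Q.withDensity (acc W x) +
        (1 - ∫⁻ y, acc W x y ∂Q) • Measure.dirac x)
      = mhOp Q (fun z => (W z).toReal) g x := by
  have hacc : ∀ y, (acc W x y).toReal
      = accR (fun z => (W z).toReal) (W x).toReal y := by
    intro y
    simp only [acc, accR]
    rcases eq_or_ne (W x) 0 with hx | hx
    · rcases eq_or_ne (W y) 0 with hy | hy
      · simp [hx, hy]
      · have : 0 < (W y).toReal := ENNReal.toReal_pos hy (hWt y)
        simp [hx, ENNReal.div_zero hy, this.le, div_self this.ne']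
    · have hxp : 0 < (W x).toReal := ENNReal.toReal_pos hx (hWt x)
      rw [ENNReal.toReal_min ENNReal.one_ne_top (ENNReal.div_ne_top (hWt y) hx),
        ENNReal.toReal_div, ENNReal.toReal_one]
      rcases le_total (W x).toReal (W y).toReal with hle | hle
      · rw [max_eq_right hle, min_eq_left ((one_le_div hxp).2 hle),
          div_self (hxp.trans_le hle).ne']
      · rw [max_eq_left hle, min_eq_right ((div_le_one hxp).2 hle)]
  have haccm : Measurable (acc W x) := measurable_const.min (hWm.div_const _)
  have hacc1 : ∀ y, acc W x y ≤ 1 := fun y => min_le_left _ _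
  have hacct : ∀ y, acc W x y < ⊤ := fun y => (hacc1 y).trans_lt ENNReal.one_lt_top
  have hI1 : ∫⁻ y, acc W x y ∂Q ≤ 1 := by
    calc ∫⁻ y, acc W x y ∂Q ≤ ∫⁻ _, 1 ∂Q := lintegral_mono hacc1
      _ = 1 := by simp
  have hwr : Measurable fun z => (W z).toReal := hWm.ennreal_toReal
  have hwr0 : ∀ z, 0 ≤ (W z).toReal := fun z => ENNReal.toReal_nonneg
  have hfin : IsFiniteMeasure (Q.withDensity (acc W x)) :=
    isFiniteMeasure_withDensity (hI1.trans_lt ENNReal.one_lt_top).ne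
  have hIr : (∫⁻ y, acc W x y ∂Q).toReal
      = ∫ y, accR (fun z => (W z).toReal) (W x).toReal y ∂Q := by
    rw [← integral_toReal haccm.aemeasurable (ae_of_all _ hacct)]
    simp only [hacc]
  rw [integral_add_measure (integrable_of_abs_le hgm hg)
      ((integrable_of_abs_le hgm hg).smul_measure (ENNReal.sub_ne_top ENNReal.one_ne_top)),
    integral_withDensity_eq_integral_toReal_smul haccm (ae_of_all _ hacct),
    integral_smul_measure, integral_dirac' _ _ hgm.stronglyMeasurable,
    ENNReal.toReal_sub_of_le hI1 ENNReal.one_ne_top, hIr, mhOp]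
  simp only [hacc, smul_eq_mul, ENNReal.toReal_one]

end UniformComparison

section Mixing

variable {Ω : Type*} {mΩ : MeasurableSpace Ω} {μ : Measure Ω} [IsProbabilityMeasure μ]

/-- A weak law of large numbers for bounded variables with uniformly decaying correlations. -/
lemma tendsto_integral_abs_average_of_mixing {V : ℕ → Ω → ℝ} (hVm : ∀ i, Measurable (V i))
    (hV : ∀ i ω, |V i ω| ≤ 1)
    (hmix : ∀ ε > 0, ∃ I N : ℕ, ∀ i ≥ I, ∀ j ≤ i, |∫ ω, V j ω * V (i + N) ω ∂μ| ≤ ε) :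
    Filter.Tendsto (fun k : ℕ => ∫ ω, |((k : ℝ) + 1)⁻¹ * ∑ i ∈ Finset.range (k + 1), V i ω| ∂μ)
      Filter.atTop (nhds 0) := by
  have hVV : ∀ i j ω, |V i ω * V j ω| ≤ 1 := fun i j ω => by
    rw [abs_mul]; exact mul_le_one₀ (hV i ω) (abs_nonneg _) (hV j ω)
  have iVV : ∀ i j, Integrable (fun ω => V i ω * V j ω) μ := fun i j =>
    integrable_of_abs_le ((hVm i).mul (hVm j)) (hVV i j)
  have bVV : ∀ i j, ∫ ω, V i ω * V j ω ∂μ ≤ 1 := fun i j => by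
    simpa using integral_mono (iVV i j) (integrable_const (1 : ℝ)) fun ω => (abs_le.1 (hVV i j ω)).2
  have hSm : ∀ k, Measurable fun ω => ∑ i ∈ Finset.range k, V i ω := fun k =>
    Finset.measurable_sum _ fun i _ => hVm i
  have hSb : ∀ (k : ℕ) ω, |∑ i ∈ Finset.range k, V i ω| ≤ k := fun k ω => by
    refine (Finset.abs_sum_le_sum_abs _ _).trans ?_
    simpa using Finset.sum_le_sum fun i (_ : i ∈ Finset.range k) => hV i ω
  have iS2 : ∀ k : ℕ, Integrable (fun ω => (∑ i ∈ Finset.range k, V i ω) ^ 2) μ := fun k =>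
    integrable_of_abs_le ((hSm k).pow_const 2) (C := (k : ℝ) ^ 2) fun ω => by
      rw [abs_pow]; exact pow_le_pow_left₀ (abs_nonneg _) (hSb k ω) 2
  have iSV : ∀ k : ℕ, Integrable (fun ω => (∑ i ∈ Finset.range k, V i ω) * V k ω) μ := fun k =>
    integrable_of_abs_le ((hSm k).mul (hVm k)) (C := (k : ℝ)) fun ω => by
      rw [abs_mul]
      exact (mul_le_of_le_one_right (abs_nonneg _) (hV k ω)).trans (hSb k ω)
  have growth : ∀ ε > 0, ∃ I N : ℕ, ∀ k ≥ I + N,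
      ∫ ω, (∑ i ∈ Finset.range k, V i ω) ^ 2 ∂μ
        ≤ ((I + N : ℕ) : ℝ) ^ 2 + ε * (k : ℝ) ^ 2 + (2 * N + 1) * k := by
    intro ε hε
    obtain ⟨I, N, h⟩ := hmix ε hε
    refine ⟨I, N, fun k hk => ?_⟩
    induction k, hk using Nat.le_induction with
    | base =>
      have : ∫ ω, (∑ i ∈ Finset.range (I + N), V i ω) ^ 2 ∂μ ≤ ((I + N : ℕ) : ℝ) ^ 2 := by
        simpa using integral_mono (iS2 (I + N)) (integrable_const (((I + N : ℕ) : ℝ) ^ 2))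
          fun ω => by
            simp only
            rw [← sq_abs]
            exact pow_le_pow_left₀ (abs_nonneg _) (hSb (I + N) ω) 2
      have h2 : 0 ≤ ε * ((I + N : ℕ) : ℝ) ^ 2 + (2 * N + 1) * ((I + N : ℕ) : ℝ) := by positivity
      linarith
    | succ k hk ih =>
      obtain ⟨i, rfl⟩ : ∃ i, k = i + N := ⟨k - N, by omega⟩
      have hi : I ≤ i := by omega
      have hcross : ∫ ω, (∑ j ∈ Finset.range (i + N), V j ω) * V (i + N) ω ∂μ ≤ i * ε + N := by
        simp only [Finset.sum_mul]
        rw [integral_finsetSum _ fun j _ => iVV j _, Finset.sum_range_add]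
        refine add_le_add ?_ ?_
        · refine (Finset.sum_le_sum fun j hj => (abs_le.1 (h i hi j
            (Finset.mem_range.1 hj).le)).2).trans ?_
          simp
        · refine (Finset.sum_le_sum fun j _ => bVV (i + j) (i + N)).trans ?_
          simp
      have hexp : ∀ ω, (∑ j ∈ Finset.range (i + N + 1), V j ω) ^ 2
          = (∑ j ∈ Finset.range (i + N), V j ω) ^ 2
            + (2 * ((∑ j ∈ Finset.range (i + N), V j ω) * V (i + N) ω)
              + V (i + N) ω * V (i + N) ω) := fun ω => by
        rw [Finset.sum_range_succ]; ring
      simp only [hexp]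
      have i2 : Integrable (fun ω => 2 * ((∑ j ∈ Finset.range (i + N), V j ω) * V (i + N) ω)
              + V (i + N) ω * V (i + N) ω) μ := ((iSV _).const_mul 2).add (iVV _ _)
      rw [integral_add (iS2 _) i2, integral_add ((iSV _).const_mul 2) (iVV _ _),
        integral_const_mul]
      have := bVV (i + N) (i + N)
      have hNε : 0 ≤ ε * (2 * N + 1) := by positivity
      push_cast at ih ⊢
      nlinarith
  have hAm : ∀ k : ℕ, Integrable
      (fun ω => |((k : ℝ) + 1)⁻¹ * ∑ i ∈ Finset.range (k + 1), V i ω|) μ := fun k =>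
    (integrable_of_abs_le ((hSm (k + 1)).const_mul _) (C := ((k : ℝ) + 1)⁻¹ * (k + 1 : ℕ))
      fun ω => by
        rw [abs_mul, abs_of_nonneg (by positivity)]
        exact mul_le_mul_of_nonneg_left (hSb (k + 1) ω) (by positivity)).abs
  have hbound : ∀ η > 0, ∀ k : ℕ, ∫ ω, |((k : ℝ) + 1)⁻¹ * ∑ i ∈ Finset.range (k + 1), V i ω| ∂μ
      ≤ η + η⁻¹ * ((((k : ℝ) + 1)⁻¹) ^ 2
          * ∫ ω, (∑ i ∈ Finset.range (k + 1), V i ω) ^ 2 ∂μ) := by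
    intro η hη k
    have hint : Integrable (fun ω => η + η⁻¹ * ((((k : ℝ) + 1)⁻¹) ^ 2
          * (∑ i ∈ Finset.range (k + 1), V i ω) ^ 2)) μ :=
      (integrable_const η).add (((iS2 (k + 1)).const_mul _).const_mul _)
    have := integral_mono (hAm k) hint fun ω => by
      simp only
      rw [← mul_pow]
      set x := ((k : ℝ) + 1)⁻¹ * ∑ i ∈ Finset.range (k + 1), V i ω
      rw [inv_mul_eq_div, ← sub_nonneg]
      have : η + x ^ 2 / η - |x| = ((|x| - η) ^ 2 + η * |x|) / η := by
        rw [← sq_abs x]; field_simp; ring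
      rw [this]
      positivity
    rwa [integral_add (integrable_const η) (((iS2 (k + 1)).const_mul _).const_mul _),
      integral_const_mul, integral_const_mul, integral_const, probReal_univ, one_smul] at this
  rw [Metric.tendsto_atTop]
  intro e he
  obtain ⟨I, N, h⟩ := growth ((e / 4) ^ 2) (by positivity)
  have hlim : Filter.Tendsto (fun k : ℕ =>
      (((I + N : ℕ) : ℝ) ^ 2 * (((k : ℝ) + 1)⁻¹) + (2 * N + 1)) * (((k : ℝ) + 1)⁻¹))
      Filter.atTop (nhds ((((I + N : ℕ) : ℝ) ^ 2 * 0 + (2 * N + 1)) * 0)) := by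
    have h0 : Filter.Tendsto (fun k : ℕ => ((k : ℝ) + 1)⁻¹) Filter.atTop (nhds 0) := by
      simpa using tendsto_one_div_add_atTop_nhds_zero_nat (𝕜 := ℝ)
    exact ((h0.const_mul _).add_const _).mul h0
  rw [mul_zero] at hlim
  obtain ⟨K, hK⟩ := Filter.eventually_atTop.1
    (hlim.eventually (gt_mem_nhds (show 0 < (e / 4) ^ 2 by positivity)))
  refine ⟨max K (I + N), fun k hk => ?_⟩
  have hk1 := hK k (le_of_max_le_left hk)
  have hk2 := h (k + 1) ((le_of_max_le_right hk).trans (Nat.le_succ k))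
  have hk3 := hbound (e / 4) (by positivity) k
  rw [Real.dist_eq, sub_zero, abs_of_nonneg (integral_nonneg fun ω => abs_nonneg _)]
  have hpos : (0 : ℝ) < (k : ℝ) + 1 := by positivity
  have h4 : (((k : ℝ) + 1)⁻¹) ^ 2 * ∫ ω, (∑ i ∈ Finset.range (k + 1), V i ω) ^ 2 ∂μ
      ≤ 2 * (e / 4) ^ 2 := by
    calc _ ≤ (((k : ℝ) + 1)⁻¹) ^ 2 * (((I + N : ℕ) : ℝ) ^ 2
            + (e / 4) ^ 2 * ((k + 1 : ℕ) : ℝ) ^ 2 + (2 * N + 1) * ((k + 1 : ℕ) : ℝ)) :=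
          mul_le_mul_of_nonneg_left hk2 (by positivity)
      _ = (((I + N : ℕ) : ℝ) ^ 2 * (((k : ℝ) + 1)⁻¹) + (2 * N + 1)) * (((k : ℝ) + 1)⁻¹)
            + (e / 4) ^ 2 := by
          push_cast
          field_simp
          ring
      _ ≤ _ := by linarith
  have h5 := mul_le_mul_of_nonneg_left h4 (show 0 ≤ (e / 4)⁻¹ by positivity)
  have h6 : (e / 4)⁻¹ * (2 * (e / 4) ^ 2) = e / 2 := by field_simp; ring
  linarith

end Mixing

section AdaptiveSampler

variable {S : Type*} [MeasurableSpace S] {Ω : Type*} {mΩ : MeasurableSpace Ω} {μ : Measure Ω}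
  [IsProbabilityMeasure μ]

/-- One step of an adaptive independent sampler is asymptotically a step of its limit kernel,
when tested against variables of the past. -/
lemma exists_abs_integral_mul_sub_mhOp_le {Q : Measure S} [IsProbabilityMeasure Q]
    {W : S → ℝ≥0∞} (hWm : Measurable W) {B : ℝ≥0∞} (hB : B ≠ ⊤) (hWB : ∀ x, W x ≤ B)
    {Y : ℕ → Ω → S} {𝓕 : ℕ → MeasurableSpace Ω} (h𝓕 : ∀ i, 𝓕 i ≤ mΩ)
    (hYm : ∀ i, Measurable (Y i)) {Q' : ℕ → Ω → Measure S}
    (hQ' : ∀ i ω, IsProbabilityMeasure (Q' i ω))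
    (hcond : ∀ i, ∀ g : S → ℝ, Measurable g → (∀ z, |g z| ≤ 1) →
      (μ[(fun ω => g (Y (i + 1) ω))|𝓕 (i + 1)]) =ᵐ[μ]
        fun ω => ∫ z, g z ∂((Q' (i + 1) ω).withDensity (acc W (Y i ω)) +
          (1 - ∫⁻ y, acc W (Y i ω) y ∂(Q' (i + 1) ω)) • Measure.dirac (Y i ω)))
    (hint : ∀ φ : S → ℝ, Measurable φ → (∀ z, |φ z| ≤ 1) →
      ∀ i, Integrable (fun ω => |∫ z, φ z ∂(Q' i ω) - ∫ z, φ z ∂Q|) μ)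
    (hconv : ∀ φ : S → ℝ, Measurable φ → (∀ z, |φ z| ≤ 1) →
      Filter.Tendsto (fun i => ∫ ω, |∫ z, φ z ∂(Q' i ω) - ∫ z, φ z ∂Q| ∂μ)
        Filter.atTop (nhds 0))
    {g : S → ℝ} (hgm : Measurable g) (hg : ∀ z, |g z| ≤ 1) {ε : ℝ} (hε : 0 < ε) :
    ∃ I : ℕ, ∀ i ≥ I, ∀ U : Ω → ℝ, Measurable[𝓕 (i + 1)] U → (∀ ω, |U ω| ≤ 1) →
      |∫ ω, U ω * g (Y (i + 1) ω) ∂μ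
        - ∫ ω, U ω * mhOp Q (fun z => (W z).toReal) g (Y i ω) ∂μ| ≤ ε := by
  have hWt : ∀ x, W x ≠ ⊤ := fun x => ((hWB x).trans_lt hB.lt_top).ne
  set w : S → ℝ := fun z => (W z).toReal
  have hwm : Measurable w := hWm.ennreal_toReal
  have hw : ∀ x, 0 ≤ w x := fun x => ENNReal.toReal_nonneg
  have hwb : ∀ x, w x ≤ B.toReal := fun x => ENNReal.toReal_mono hB (hWB x)
  obtain ⟨T, φ, ψ, hφ, hψ, hT⟩ := exists_testFunctions_mhOp Q hwm hw hwb hgm hg (half_pos hε)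
  have hlim : Filter.Tendsto (fun i => 2 * ∑ s ∈ T,
      ((∫ ω, |∫ z, φ s z ∂(Q' i ω) - ∫ z, φ s z ∂Q| ∂μ)
        + ∫ ω, |∫ z, ψ s z ∂(Q' i ω) - ∫ z, ψ s z ∂Q| ∂μ)) Filter.atTop
      (nhds (2 * ∑ _s ∈ T, ((0 : ℝ) + 0))) :=
    (tendsto_finsetSum _ fun s _ => (hconv _ (hφ s).1 (hφ s).2).add
      (hconv _ (hψ s).1 (hψ s).2)).const_mul 2
  simp only [add_zero, Finset.sum_const_zero, mul_zero] at hlim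
  obtain ⟨I, hI⟩ := Filter.eventually_atTop.1 (hlim.eventually (gt_mem_nhds (half_pos hε)))
  refine ⟨I, fun i hi U hUm hU => ?_⟩
  have hc := hcond i g hgm hg
  have hc' : (μ[(fun ω => g (Y (i + 1) ω))|𝓕 (i + 1)]) =ᵐ[μ]
      fun ω => mhOp (Q' (i + 1) ω) w g (Y i ω) := by
    refine hc.trans (ae_of_all _ fun ω => ?_)
    have := hQ' (i + 1) ω
    exact integral_mhKernel hWm hWt hgm hg _
  have hUm' : Measurable U := hUm.mono (h𝓕 _) le_rfl
  have hgY : Measurable fun ω => g (Y (i + 1) ω) := hgm.comp (hYm _)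
  have hUg : ∀ ω, |U ω * g (Y (i + 1) ω)| ≤ 1 := fun ω => by
    rw [abs_mul]; exact mul_le_one₀ (hU ω) (abs_nonneg _) (hg _)
  have hpull : ∫ ω, U ω * g (Y (i + 1) ω) ∂μ
      = ∫ ω, U ω * mhOp (Q' (i + 1) ω) w g (Y i ω) ∂μ := by
    have e := condExp_mul_of_stronglyMeasurable_left (μ := μ) (m := 𝓕 (i + 1)) (f := U)
      (g := fun ω => g (Y (i + 1) ω)) hUm.stronglyMeasurable
      (integrable_of_abs_le (hUm'.mul hgY) hUg) (integrable_of_abs_le hgY fun ω => hg _)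
    calc _ = ∫ ω, (μ[U * (fun ω => g (Y (i + 1) ω))|𝓕 (i + 1)]) ω ∂μ :=
          (integral_condExp (h𝓕 _)).symm
      _ = _ := by
          refine integral_congr_ae ?_
          filter_upwards [e, hc'] with ω h1 h2
          rw [h1, Pi.mul_apply, h2]
  have hK : Measurable fun ω => mhOp Q w g (Y i ω) := (measurable_mhOp hwm hgm).comp (hYm i)
  have hKint : Integrable (fun ω => mhOp Q w g (Y i ω)) μ :=
    integrable_of_abs_le hK fun ω => abs_mhOp_le hwm hw hg _
  have hK'int : Integrable (fun ω => mhOp (Q' (i + 1) ω) w g (Y i ω)) μ :=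
    integrable_condExp.congr hc'
  have hU_bd : ∀ᵐ ω ∂μ, ‖U ω‖ ≤ 1 := ae_of_all _ hU
  have i1 : Integrable (fun ω => U ω * mhOp Q w g (Y i ω)) μ :=
    hKint.bdd_mul hUm'.aestronglyMeasurable hU_bd
  have i2 : Integrable (fun ω => U ω * mhOp (Q' (i + 1) ω) w g (Y i ω)) μ :=
    hK'int.bdd_mul hUm'.aestronglyMeasurable hU_bd
  rw [hpull, ← integral_sub i2 i1]
  have hDi : ∀ s ∈ T, Integrable (fun ω =>
      |∫ z, φ s z ∂(Q' (i + 1) ω) - ∫ z, φ s z ∂Q|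
        + |∫ z, ψ s z ∂(Q' (i + 1) ω) - ∫ z, ψ s z ∂Q|) μ := fun s _ =>
    (hint _ (hφ s).1 (hφ s).2 _).add (hint _ (hψ s).1 (hψ s).2 _)
  have hDint : Integrable (fun ω => ε / 2 + 2 * ∑ s ∈ T,
      (|∫ z, φ s z ∂(Q' (i + 1) ω) - ∫ z, φ s z ∂Q|
        + |∫ z, ψ s z ∂(Q' (i + 1) ω) - ∫ z, ψ s z ∂Q|)) μ :=
    (integrable_const _).add ((integrable_finsetSum _ hDi).const_mul 2)
  have hle : |∫ ω, (U ω * mhOp (Q' (i + 1) ω) w g (Y i ω) - U ω * mhOp Q w g (Y i ω)) ∂μ|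
      ≤ ∫ ω, (ε / 2 + 2 * ∑ s ∈ T,
      (|∫ z, φ s z ∂(Q' (i + 1) ω) - ∫ z, φ s z ∂Q|
        + |∫ z, ψ s z ∂(Q' (i + 1) ω) - ∫ z, ψ s z ∂Q|)) ∂μ := by
    rw [← Real.norm_eq_abs]
    refine norm_integral_le_of_norm_le hDint (ae_of_all _ fun ω => ?_)
    rw [Real.norm_eq_abs, ← mul_sub, abs_mul]
    exact (mul_le_of_le_one_left (abs_nonneg _) (hU ω)).trans (hT _ (hQ' _ ω) _)
  refine hle.trans ?_
  rw [integral_add (integrable_const _) ((integrable_finsetSum _ hDi).const_mul 2),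
    integral_const_mul, integral_finsetSum _ hDi, integral_const, probReal_univ, one_smul]
  have e3 : ∀ s ∈ T, ∫ ω, (|∫ z, φ s z ∂(Q' (i + 1) ω) - ∫ z, φ s z ∂Q|
        + |∫ z, ψ s z ∂(Q' (i + 1) ω) - ∫ z, ψ s z ∂Q|) ∂μ
      = (∫ ω, |∫ z, φ s z ∂(Q' (i + 1) ω) - ∫ z, φ s z ∂Q| ∂μ)
        + ∫ ω, |∫ z, ψ s z ∂(Q' (i + 1) ω) - ∫ z, ψ s z ∂Q| ∂μ := fun s _ =>
    integral_add (hint _ (hφ s).1 (hφ s).2 _) (hint _ (hψ s).1 (hψ s).2 _)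
  rw [Finset.sum_congr rfl e3]
  have := hI (i + 1) (hi.trans (Nat.le_succ i))
  linarith

/-- Ergodicity of adaptive independent Metropolis–Hastings samplers whose proposals converge:
the weak law of large numbers and convergence of the marginals. -/
theorem adaptiveSampler_ergodic {Q π : Measure S} [IsProbabilityMeasure Q]
    [IsProbabilityMeasure π]
    {W : S → ℝ≥0∞} (hWm : Measurable W) {B : ℝ≥0∞} (hB : B ≠ ⊤) (hWB : ∀ x, W x ≤ B)
    {c : ℝ≥0∞} (hc0 : c ≠ 0) (hct : c ≠ ⊤) (hπ : Q.withDensity W = c • π)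
    {Y : ℕ → Ω → S} {𝓕 : ℕ → MeasurableSpace Ω} (h𝓕 : ∀ i, 𝓕 i ≤ mΩ) (hmono : Monotone 𝓕)
    (hY : ∀ i, Measurable[𝓕 (i + 1)] (Y i)) {Q' : ℕ → Ω → Measure S}
    (hQ' : ∀ i ω, IsProbabilityMeasure (Q' i ω))
    (hcond : ∀ i, ∀ g : S → ℝ, Measurable g → (∀ z, |g z| ≤ 1) →
      (μ[(fun ω => g (Y (i + 1) ω))|𝓕 (i + 1)]) =ᵐ[μ]
        fun ω => ∫ z, g z ∂((Q' (i + 1) ω).withDensity (acc W (Y i ω)) +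
          (1 - ∫⁻ y, acc W (Y i ω) y ∂(Q' (i + 1) ω)) • Measure.dirac (Y i ω)))
    (hint : ∀ φ : S → ℝ, Measurable φ → (∀ z, |φ z| ≤ 1) →
      ∀ i, Integrable (fun ω => |∫ z, φ z ∂(Q' i ω) - ∫ z, φ z ∂Q|) μ)
    (hconv : ∀ φ : S → ℝ, Measurable φ → (∀ z, |φ z| ≤ 1) →
      Filter.Tendsto (fun i => ∫ ω, |∫ z, φ z ∂(Q' i ω) - ∫ z, φ z ∂Q| ∂μ)
        Filter.atTop (nhds 0))
    {f : S → ℝ} (hfm : Measurable f) (hf : ∀ z, |f z| ≤ 1) :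
    Filter.Tendsto (fun k : ℕ => ∫ ω, |((k : ℝ) + 1)⁻¹ * ∑ i ∈ Finset.range (k + 1), f (Y i ω)
        - ∫ z, f z ∂π| ∂μ) Filter.atTop (nhds 0) ∧
      Filter.Tendsto (fun i => ∫ ω, f (Y i ω) ∂μ) Filter.atTop (nhds (∫ z, f z ∂π)) := by
  have hYm : ∀ i, Measurable (Y i) := fun i => (hY i).mono (h𝓕 _) le_rfl
  set w : S → ℝ := fun z => (W z).toReal
  have hwm : Measurable w := hWm.ennreal_toReal
  have hw : ∀ x, 0 ≤ w x := fun x => ENNReal.toReal_nonneg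
  set b : ℝ := B.toReal + 1 with hb_def
  have hb : 0 < b := by positivity
  have hwb : ∀ x, w x ≤ b := fun x => (ENNReal.toReal_mono hB (hWB x)).trans (by simp [hb_def])
  have hwint : ∀ g : S → ℝ, ∫ x, w x * g x ∂Q = c.toReal * ∫ x, g x ∂π := fun g => by
    have h1 := integral_withDensity_eq_integral_toReal_smul (μ := Q) hWm
      (ae_of_all _ fun x => (hWB x).trans_lt hB.lt_top) g
    rw [hπ, integral_smul_measure] at h1
    exact h1.symm
  have hw1 : ∫ x, w x ∂Q = c.toReal := by simpa using hwint fun _ => 1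
  have hcpos : 0 < c.toReal := ENNReal.toReal_pos hc0 hct
  have hρ0 : 0 ≤ 1 - (∫ y, w y ∂Q) / b := by
    rw [sub_nonneg, div_le_one hb]
    simpa using integral_mono (μ := Q) (integrable_of_abs_le hwm (C := b) fun y => by
      rw [abs_of_nonneg (hw y)]; exact hwb y) (integrable_const b) hwb
  have hρ1 : 1 - (∫ y, w y ∂Q) / b < 1 := by
    rw [hw1]
    have := div_pos hcpos hb
    linarith
  set p := ∫ z, f z ∂π with hp
  have hp1 : |p| ≤ 1 := by
    have := norm_integral_le_of_norm_le_const (μ := π) (f := f) (ae_of_all _ hf)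
    simpa using this
  have hfp : ∀ x, |f x - p| ≤ 2 := fun x => (abs_sub _ _).trans (by linarith [hf x])
  -- iterating the one-step comparison
  have steps : ∀ N : ℕ, ∀ g : S → ℝ, Measurable g → (∀ z, |g z| ≤ 1) → ∀ ε > 0,
      ∃ I : ℕ, ∀ i ≥ I, ∀ U : Ω → ℝ, Measurable[𝓕 (i + 1)] U → (∀ ω, |U ω| ≤ 1) →
        |∫ ω, U ω * g (Y (i + N) ω) ∂μ - ∫ ω, U ω * (mhOp Q w)^[N] g (Y i ω) ∂μ| ≤ ε := by
    intro N
    induction N with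
    | zero => intro g _ _ ε hε; exact ⟨0, fun i _ U _ _ => by simpa using hε.le⟩
    | succ N ih =>
      intro g hgm hg ε hε
      obtain ⟨I₁, h₁⟩ := ih (mhOp Q w g) (measurable_mhOp hwm hgm) (abs_mhOp_le hwm hw hg)
        (ε / 2) (half_pos hε)
      obtain ⟨I₂, h₂⟩ := exists_abs_integral_mul_sub_mhOp_le hWm hB hWB h𝓕 hYm hQ' hcond hint
        hconv hgm hg (half_pos hε)
      refine ⟨max I₁ I₂, fun i hi U hUm hU => ?_⟩
      have a₁ := h₁ i (le_of_max_le_left hi) U hUm hU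
      have a₂ := h₂ (i + N) ((le_of_max_le_right hi).trans (Nat.le_add_right _ _)) U
        (hUm.mono (hmono (by omega)) le_rfl) hU
      rw [Function.iterate_succ_apply]
      calc _ ≤ _ := abs_sub_le _ (∫ ω, U ω * mhOp Q w g (Y (i + N) ω) ∂μ) _
        _ ≤ ε := by
          rw [← add_assoc]
          linarith
  have mix : ∀ ε > 0, ∃ I N : ℕ, ∀ i ≥ I, ∀ U : Ω → ℝ, Measurable[𝓕 (i + 1)] U →
      (∀ ω, |U ω| ≤ 1) → |∫ ω, U ω * (f (Y (i + N) ω) - p) ∂μ| ≤ ε := by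
    intro ε hε
    obtain ⟨N, hN⟩ := exists_pow_lt_of_lt_one (show 0 < ε / 4 by positivity) hρ1
    obtain ⟨I, hI⟩ := steps N f hfm hf (ε / 2) (half_pos hε)
    refine ⟨I, N, fun i hi U hUm hU => ?_⟩
    have a := hI i hi U hUm hU
    have hUm' : Measurable U := hUm.mono (h𝓕 _) le_rfl
    have hU_bd : ∀ᵐ ω ∂μ, ‖U ω‖ ≤ 1 := ae_of_all _ hU
    have hKb := abs_iterate_mhOp_sub_le (Q := Q) hwm hw hb hwb N hfm hfp
      (by rw [hwint, hw1, mul_comm])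
    have iU : Integrable U μ := integrable_of_abs_le hUm' hU
    have iF : Integrable (fun ω => U ω * f (Y (i + N) ω)) μ :=
      (integrable_of_abs_le (hfm.comp (hYm _)) fun ω => hf _).bdd_mul
        hUm'.aestronglyMeasurable hU_bd
    have hKc : Measurable fun ω => (mhOp Q w)^[N] f (Y i ω) - p :=
      ((measurable_iterate_mhOp hwm N hfm).comp (hYm i)).sub_const p
    have iKc : Integrable (fun ω => (mhOp Q w)^[N] f (Y i ω) - p) μ :=
      integrable_of_abs_le hKc fun ω => hKb _
    have iUKc : Integrable (fun ω => U ω * ((mhOp Q w)^[N] f (Y i ω) - p)) μ :=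
      iKc.bdd_mul hUm'.aestronglyMeasurable hU_bd
    have e1 : ∫ ω, U ω * (f (Y (i + N) ω) - p) ∂μ
        = (∫ ω, U ω * f (Y (i + N) ω) ∂μ) - (∫ ω, U ω ∂μ) * p := by
      simp only [mul_sub]
      rw [integral_sub iF (iU.mul_const p), integral_mul_const]
    have e2 : ∫ ω, U ω * (mhOp Q w)^[N] f (Y i ω) ∂μ
        = (∫ ω, U ω * ((mhOp Q w)^[N] f (Y i ω) - p) ∂μ) + (∫ ω, U ω ∂μ) * p := by
      rw [← integral_mul_const, ← integral_add iUKc (iU.mul_const p)]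
      refine integral_congr_ae (ae_of_all _ fun ω => ?_)
      simp only
      ring
    have e3 : |∫ ω, U ω * ((mhOp Q w)^[N] f (Y i ω) - p) ∂μ| ≤ ε / 2 := by
      have := norm_integral_le_of_norm_le_const (μ := μ) (C := ε / 2)
        (f := fun ω => U ω * ((mhOp Q w)^[N] f (Y i ω) - p)) (ae_of_all _ fun ω => by
          rw [Real.norm_eq_abs, abs_mul]
          refine (mul_le_of_le_one_left (abs_nonneg _) (hU ω)).trans ((hKb _).trans ?_)
          linarith)
      simpa using this
    rw [e1]
    rw [e2] at a
    rw [abs_le] at a e3 ⊢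
    constructor <;> linarith
  constructor
  · have hV := tendsto_integral_abs_average_of_mixing (μ := μ)
      (V := fun i ω => (f (Y i ω) - p) / 2)
      (fun i => ((hfm.comp (hYm i)).sub_const p).div_const 2)
      (fun i ω => by rw [abs_div, abs_two]; linarith [hfp (Y i ω)])
      (fun ε hε => by
        obtain ⟨I, N, h⟩ := mix ε hε
        refine ⟨I, N, fun i hi j hj => ?_⟩
        have hUm : Measurable[𝓕 (i + 1)] fun ω => (f (Y j ω) - p) / 2 :=
          (((hfm.comp (hY j)).mono (hmono (by omega)) le_rfl).sub_const p).div_const 2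
        have := h i hi _ hUm (fun ω => by rw [abs_div, abs_two]; linarith [hfp (Y j ω)])
        simp only [mul_div_assoc', integral_div]
        rw [abs_div, abs_two]
        linarith [abs_nonneg (∫ ω, (f (Y j ω) - p) / 2 * (f (Y (i + N) ω) - p) ∂μ)])
    have h2 := hV.const_mul 2
    rw [mul_zero] at h2
    refine h2.congr fun k => ?_
    rw [← integral_const_mul]
    refine integral_congr_ae (ae_of_all _ fun ω => ?_)
    have hk : ((k : ℝ) + 1) ≠ 0 := by positivity
    simp only
    rw [← Finset.sum_div, Finset.sum_sub_distrib, Finset.sum_const, Finset.card_range,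
      ← abs_two (α := ℝ), ← abs_mul, abs_two]
    congr 1
    rw [nsmul_eq_mul]
    push_cast
    field_simp
  · rw [Metric.tendsto_atTop]
    intro ε hε
    obtain ⟨I, N, h⟩ := mix (ε / 2) (half_pos hε)
    refine ⟨I + N, fun n hn => ?_⟩
    obtain ⟨i, rfl⟩ : ∃ i, n = i + N := ⟨n - N, by omega⟩
    have := h i (by omega) (fun _ => 1) measurable_const (by simp)
    simp only [one_mul] at this
    have iF : Integrable (fun ω => f (Y (i + N) ω)) μ :=
      integrable_of_abs_le (hfm.comp (hYm _)) fun ω => hf _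
    rw [integral_sub iF (integrable_const p), integral_const, probReal_univ, one_smul] at this
    rw [Real.dist_eq]
    linarith

end AdaptiveSampler

section Proposals

variable {dx : Measure E}

lemma measurable_snoc (m : ℕ) :
    Measurable fun p : (Fin m → E) × E => (Fin.snoc p.1 p.2 : Fin (m + 1) → E) := by
  refine measurable_pi_iff.2 fun i => ?_
  refine Fin.lastCases ?_ (fun j => ?_) i
  · simpa using measurable_snd
  · simp only [Fin.snoc_castSucc]
    exact (measurable_pi_apply j).comp measurable_fst

lemma measurable_init (m : ℕ) :
    Measurable fun x : Fin (m + 1) → E => (Fin.init x : Fin m → E) :=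
  measurable_pi_iff.2 fun i => measurable_pi_apply i.castSucc

lemma lintegral_pi_succ [SigmaFinite dx] (m : ℕ) {F : (Fin (m + 1) → E) → ℝ≥0∞}
    (hF : Measurable F) :
    ∫⁻ x, F x ∂(Measure.pi fun _ : Fin (m + 1) => dx)
      = ∫⁻ z, ∫⁻ y, F (Fin.snoc z y) ∂dx ∂(Measure.pi fun _ : Fin m => dx) := by
  have h := measurePreserving_piFinSuccAbove (fun _ : Fin (m + 1) => dx) (Fin.last m)
  have h' := h.symm.lintegral_comp hF
  rw [← h', lintegral_prod_symm']
  · refine lintegral_congr fun z => lintegral_congr fun y => ?_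
    congr 1
    exact Fin.insertNth_last' y z
  · exact hF.comp (MeasurableEquiv.measurable _)

lemma lintegral_propM [SigmaFinite dx] {q : (m : ℕ) → (Fin m → E) → E → ℝ≥0∞} {m : ℕ}
    (hq : Measurable fun p : (Fin m → E) × E => q m p.1 p.2) (μ : Measure (Fin m → E))
    {F : (Fin (m + 1) → E) → ℝ≥0∞} (hF : Measurable F) :
    ∫⁻ x, F x ∂(propM dx q m μ) = ∫⁻ z, ∫⁻ y, q m z y * F (Fin.snoc z y) ∂dx ∂μ := by
  have hFs : Measurable fun p : (Fin m → E) × E => F (Fin.snoc p.1 p.2) :=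
    hF.comp (measurable_snoc m)
  rw [propM, lintegral_map hF (measurable_snoc m),
    lintegral_withDensity_eq_lintegral_mul _ hq hFs, lintegral_prod _ (hq.mul hFs).aemeasurable]
  rfl

lemma isProbabilityMeasure_propM [SigmaFinite dx] {q : (m : ℕ) → (Fin m → E) → E → ℝ≥0∞}
    {m : ℕ} (hq : Measurable fun p : (Fin m → E) × E => q m p.1 p.2)
    (hd : ∀ x, ∫⁻ y, q m x y ∂dx = 1) (μ : Measure (Fin m → E)) [IsProbabilityMeasure μ] :
    IsProbabilityMeasure (propM dx q m μ) := by
  refine ⟨?_⟩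
  have := lintegral_propM (dx := dx) hq μ (F := fun _ => 1) measurable_const
  simpa [hd] using this

/-- The conditional expectation of `φ` under the transition density `q m`. -/
def propT (dx : Measure E) (q : (m : ℕ) → (Fin m → E) → E → ℝ≥0∞) (m : ℕ)
    (φ : (Fin (m + 1) → E) → ℝ) (z : Fin m → E) : ℝ :=
  ∫ y, (q m z y).toReal * φ (Fin.snoc z y) ∂dx

lemma measurable_propT [SigmaFinite dx] {q : (m : ℕ) → (Fin m → E) → E → ℝ≥0∞} {m : ℕ}
    (hq : Measurable fun p : (Fin m → E) × E => q m p.1 p.2)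
    {φ : (Fin (m + 1) → E) → ℝ} (hφ : Measurable φ) : Measurable (propT dx q m φ) :=
  (StronglyMeasurable.integral_prod_right
    (f := fun z y => (q m z y).toReal * φ (Fin.snoc z y))
    (hq.ennreal_toReal.mul (hφ.comp (measurable_snoc m))).stronglyMeasurable).measurable

lemma abs_propT_le {q : (m : ℕ) → (Fin m → E) → E → ℝ≥0∞} {m : ℕ}
    (hq : Measurable fun p : (Fin m → E) × E => q m p.1 p.2)
    (hd : ∀ x, ∫⁻ y, q m x y ∂dx = 1) {φ : (Fin (m + 1) → E) → ℝ}
    (hφ : ∀ z, |φ z| ≤ 1) (z : Fin m → E) : |propT dx q m φ z| ≤ 1 := by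
  have hqz : Measurable (q m z) := hq.comp measurable_prodMk_left
  have hint : Integrable (fun y => (q m z y).toReal) dx :=
    integrable_toReal_of_lintegral_ne_top hqz.aemeasurable (by simp [hd])
  have h1 : ∫ y, (q m z y).toReal ∂dx = 1 := by
    rw [integral_toReal hqz.aemeasurable (ae_lt_top hqz (by simp [hd])), hd, ENNReal.toReal_one]
  rw [← h1, ← Real.norm_eq_abs]
  refine norm_integral_le_of_norm_le hint (ae_of_all _ fun y => ?_)
  rw [Real.norm_eq_abs, abs_mul, abs_of_nonneg ENNReal.toReal_nonneg]
  exact mul_le_of_le_one_right ENNReal.toReal_nonneg (hφ _)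

lemma integral_propM [SigmaFinite dx] {q : (m : ℕ) → (Fin m → E) → E → ℝ≥0∞} {m : ℕ}
    (hq : Measurable fun p : (Fin m → E) × E => q m p.1 p.2) (hqfin : ∀ x y, q m x y ≠ ⊤)
    (hd : ∀ x, ∫⁻ y, q m x y ∂dx = 1) (μ : Measure (Fin m → E)) [IsProbabilityMeasure μ]
    {φ : (Fin (m + 1) → E) → ℝ} (hφm : Measurable φ) (hφ : ∀ z, |φ z| ≤ 1) :
    ∫ x, φ x ∂(propM dx q m μ) = ∫ z, propT dx q m φ z ∂μ := by
  have hlt : ∀ᵐ p ∂(μ.prod dx), q m p.1 p.2 < ⊤ := ae_of_all _ fun p => (hqfin _ _).lt_top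
  have hprob := isProbabilityMeasure_propM hq hd μ
  have hint : Integrable φ (propM dx q m μ) := integrable_of_abs_le hφm hφ
  rw [propM, integrable_map_measure hφm.aestronglyMeasurable (measurable_snoc m).aemeasurable,
    integrable_withDensity_iff_integrable_smul' hq hlt] at hint
  have hint' : Integrable (fun p : (Fin m → E) × E => (q m p.1 p.2).toReal • φ (Fin.snoc p.1 p.2))
      (μ.prod dx) := hint
  rw [propM, integral_map (measurable_snoc m).aemeasurable hφm.aestronglyMeasurable,
    integral_withDensity_eq_integral_toReal_smul hq hlt, integral_prod _ hint']
  rfl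

lemma isProbabilityMeasure_tgt [SigmaFinite dx] {γ : (n : ℕ) → (Fin n → E) → ℝ≥0∞} {Z : ℕ → ℝ≥0∞}
    {n : ℕ} (hγ : Measurable (γ n)) (hZ : Z n = ∫⁻ x, γ n x ∂(Measure.pi fun _ : Fin n => dx))
    (hZ0 : 0 < Z n) (hZt : Z n ≠ ⊤) : IsProbabilityMeasure (tgt dx γ Z n) := by
  refine ⟨?_⟩
  rw [tgt, withDensity_apply _ MeasurableSet.univ, Measure.restrict_univ]
  simp only [div_eq_mul_inv]
  rw [lintegral_mul_const _ hγ, ← hZ, ENNReal.mul_inv_cancel hZ0.ne' hZt]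

lemma measurable_wgt {γ : (n : ℕ) → (Fin n → E) → ℝ≥0∞}
    {q : (m : ℕ) → (Fin m → E) → E → ℝ≥0∞} {m : ℕ} (hγ : Measurable (γ m))
    (hγ' : Measurable (γ (m + 1)))
    (hq : Measurable fun p : (Fin m → E) × E => q m p.1 p.2) : Measurable (wgt γ q m) :=
  hγ'.div ((hγ.comp (measurable_init m)).mul
    (hq.comp ((measurable_init m).prodMk (measurable_pi_apply (Fin.last m)))))

/-- Reweighting the ideal proposal yields the target up to a constant. -/
lemma propM_withDensity_wgt [SigmaFinite dx] {γ : (n : ℕ) → (Fin n → E) → ℝ≥0∞} {Z : ℕ → ℝ≥0∞}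
    {q : (m : ℕ) → (Fin m → E) → E → ℝ≥0∞} {m : ℕ} (hγ : Measurable (γ m))
    (hγ' : Measurable (γ (m + 1))) (hγfin : ∀ x, γ m x ≠ ⊤)
    (hq : Measurable fun p : (Fin m → E) × E => q m p.1 p.2) (hqpos : ∀ x y, 0 < q m x y)
    (hqfin : ∀ x y, q m x y ≠ ⊤) {B : ℝ≥0∞} (hB : B ≠ ⊤) (hwB : ∀ x, wgt γ q m x ≤ B)
    (hZ0' : Z (m + 1) ≠ 0) (hZt' : Z (m + 1) ≠ ⊤) :
    (propM dx q m (tgt dx γ Z m)).withDensity (wgt γ q m)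
      = (Z (m + 1) / Z m) • tgt dx γ Z (m + 1) := by
  have hwm := measurable_wgt hγ hγ' hq
  refine Measure.ext_of_lintegral _ fun F hF => ?_
  have hG : Measurable fun x => wgt γ q m x * F x := hwm.mul hF
  have hinner : Measurable fun z : Fin m → E =>
      ∫⁻ y, q m z y * (wgt γ q m (Fin.snoc z y) * F (Fin.snoc z y)) ∂dx :=
    Measurable.lintegral_prod_right' (f := fun p : (Fin m → E) × E =>
      q m p.1 p.2 * (wgt γ q m (Fin.snoc p.1 p.2) * F (Fin.snoc p.1 p.2)))
      (hq.mul (hG.comp (measurable_snoc m)))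
  have hR : Measurable fun x => γ (m + 1) x / Z (m + 1) * F x := (hγ'.div_const _).mul hF
  rw [lintegral_withDensity_eq_lintegral_mul _ hwm hF, lintegral_smul_measure]
  simp only [Pi.mul_apply]
  rw [lintegral_propM hq _ hG, tgt, lintegral_withDensity_eq_lintegral_mul _ (hγ.div_const _) hinner,
    tgt, lintegral_withDensity_eq_lintegral_mul _ (hγ'.div_const _) hF]
  simp only [Pi.mul_apply]
  rw [lintegral_pi_succ m hR, smul_eq_mul, ← lintegral_const_mul _
    (Measurable.lintegral_prod_right' (f := fun p : (Fin m → E) × E =>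
      γ (m + 1) (Fin.snoc p.1 p.2) / Z (m + 1) * F (Fin.snoc p.1 p.2))
      (hR.comp (measurable_snoc m)))]
  refine lintegral_congr fun z => ?_
  have hsz : Measurable fun y : E => (Fin.snoc z y : Fin (m + 1) → E) :=
    (measurable_snoc m).comp measurable_prodMk_left
  have hqz : Measurable (q m z) := hq.comp measurable_prodMk_left
  have hl : Measurable fun y =>
      q m z y * (wgt γ q m (Fin.snoc z y) * F (Fin.snoc z y)) := hqz.mul (hG.comp hsz)
  have hr : Measurable fun y =>
      γ (m + 1) (Fin.snoc z y) / Z (m + 1) * F (Fin.snoc z y) := hR.comp hsz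
  dsimp only
  rw [← lintegral_const_mul _ hl, ← lintegral_const_mul _ hr]
  refine lintegral_congr fun y => ?_
  have hkey : γ m z * (q m z y * wgt γ q m (Fin.snoc z y)) = γ (m + 1) (Fin.snoc z y) := by
    have hw : wgt γ q m (Fin.snoc z y) = γ (m + 1) (Fin.snoc z y) / (γ m z * q m z y) := by
      simp [wgt]
    rcases eq_or_ne (γ m z) 0 with h0 | h0
    · rw [h0, zero_mul]
      by_contra hne
      have h1 := hwB (Fin.snoc z y)
      rw [hw, h0, zero_mul, ENNReal.div_zero (Ne.symm hne), top_le_iff] at h1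
      exact hB h1
    · rw [hw, ← mul_assoc]
      exact ENNReal.mul_div_cancel (mul_ne_zero h0 (hqpos _ _).ne')
        (ENNReal.mul_ne_top (hγfin _) (hqfin _ _))
  simp only [div_eq_mul_inv]
  rw [← hkey]
  calc _ = γ m z * (q m z y * wgt γ q m (Fin.snoc z y)) * F (Fin.snoc z y) * (Z m)⁻¹ * 1 := by ring
    _ = γ m z * (q m z y * wgt γ q m (Fin.snoc z y)) * F (Fin.snoc z y) * (Z m)⁻¹
        * (Z (m + 1) * (Z (m + 1))⁻¹) := by rw [ENNReal.mul_inv_cancel hZ0' hZt']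
    _ = _ := by ring

lemma measurable_wgt1 {γ : (n : ℕ) → (Fin n → E) → ℝ≥0∞} {q1 : E → ℝ≥0∞}
    (hγ : Measurable (γ 1)) (hq1 : Measurable q1) : Measurable (wgt1 γ q1) :=
  hγ.div (hq1.comp (measurable_pi_apply 0))

lemma measurable_finOne_const : Measurable fun y : E => fun _ : Fin 1 => y :=
  measurable_pi_iff.2 fun _ => measurable_id

lemma isProbabilityMeasure_prop1 {q1 : E → ℝ≥0∞} (hd : ∫⁻ y, q1 y ∂dx = 1) :
    IsProbabilityMeasure (prop1 dx q1) := by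
  have : IsProbabilityMeasure (dx.withDensity q1) := ⟨by simpa using hd⟩
  exact Measure.isProbabilityMeasure_map measurable_finOne_const.aemeasurable

lemma prop1_withDensity_wgt1 [SigmaFinite dx] {γ : (n : ℕ) → (Fin n → E) → ℝ≥0∞} {Z : ℕ → ℝ≥0∞}
    {q1 : E → ℝ≥0∞} (hγ : Measurable (γ 1)) (hq1 : Measurable q1) (hq1pos : ∀ y, 0 < q1 y)
    (hq1fin : ∀ y, q1 y ≠ ⊤) (hZ0 : Z 1 ≠ 0) (hZt : Z 1 ≠ ⊤) :
    (prop1 dx q1).withDensity (wgt1 γ q1) = Z 1 • tgt dx γ Z 1 := by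
  have hwm := measurable_wgt1 hγ hq1
  refine Measure.ext_of_lintegral _ fun F hF => ?_
  have hG : Measurable fun x => wgt1 γ q1 x * F x := hwm.mul hF
  have hR : Measurable fun x => γ 1 x / Z 1 * F x := (hγ.div_const _).mul hF
  have hpi : ∫⁻ y, γ 1 (fun _ => y) / Z 1 * F (fun _ => y) ∂dx
      = ∫⁻ x, γ 1 x / Z 1 * F x ∂(Measure.pi fun _ : Fin 1 => dx) := by
    convert (measurePreserving_funUnique dx (Fin 1)).symm.lintegral_comp hR using 3
    rfl
  have hG1 : Measurable fun y : E => wgt1 γ q1 (fun _ => y) * F (fun _ => y) :=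
    hG.comp measurable_finOne_const
  have hR1 : Measurable fun y : E => γ 1 (fun _ => y) / Z 1 * F (fun _ => y) :=
    hR.comp measurable_finOne_const
  rw [lintegral_withDensity_eq_lintegral_mul _ hwm hF, lintegral_smul_measure, tgt,
    lintegral_withDensity_eq_lintegral_mul _ (hγ.div_const _) hF]
  simp only [Pi.mul_apply]
  rw [← hpi, prop1, lintegral_map hG measurable_finOne_const,
    lintegral_withDensity_eq_lintegral_mul _ hq1 hG1, smul_eq_mul,
    ← lintegral_const_mul _ hR1]
  refine lintegral_congr fun y => ?_
  have hkey : q1 y * (wgt1 γ q1 fun _ => y) = γ 1 fun _ => y :=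
    ENNReal.mul_div_cancel (hq1pos y).ne' (hq1fin y)
  simp only [Pi.mul_apply]
  rw [← mul_assoc, hkey, ← mul_assoc, ENNReal.mul_div_cancel hZ0 hZt]

end Proposals

section Empirical

variable {Ω : Type*} (X : (n : ℕ) → ℕ → Ω → (Fin n → E))

lemma isProbabilityMeasure_emp (n i : ℕ) (ω : Ω) : IsProbabilityMeasure (emp X n i ω) := by
  refine ⟨?_⟩
  simp only [emp, Measure.smul_apply, Measure.finsetSum_apply, measure_univ, Finset.sum_const,
    Finset.card_range, smul_eq_mul, nsmul_eq_mul, mul_one]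
  push_cast
  exact ENNReal.inv_mul_cancel (by simp) (by finiteness)

lemma integral_emp (n i : ℕ) (ω : Ω) {h : (Fin n → E) → ℝ} (hm : Measurable h)
    (hb : ∀ z, |h z| ≤ 1) :
    ∫ z, h z ∂(emp X n i ω) = ((i : ℝ) + 1)⁻¹ * ∑ k ∈ Finset.range (i + 1), h (X n k ω) := by
  rw [emp, integral_smul_measure, integral_finsetSum_measure fun k _ => integrable_of_abs_le hm hb]
  simp only [integral_dirac' _ _ hm.stronglyMeasurable, ENNReal.toReal_inv, smul_eq_mul]
  congr 2

end Empirical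

section Past

variable {Ω : Type*} {P : ℕ} {X : (n : ℕ) → ℕ → Ω → (Fin n → E)} {n : ℕ}

lemma past_le {mΩ : MeasurableSpace Ω} (hX : ∀ k i, 1 ≤ k → k ≤ P → Measurable (X k i))
    (hnP : n ≤ P) (i : ℕ) : past P X n i ≤ mΩ := by
  refine iSup_le fun k => iSup_le fun j => iSup_le fun h => ?_
  exact (hX k j (by omega) (by omega)).comap_le

lemma past_mono (hnP : n ≤ P) : Monotone (past P X n) := by
  intro i j hij
  refine iSup_le fun k => iSup_le fun l => iSup_le fun h => ?_
  have h' : (1 ≤ k ∧ k ≤ P ∧ l < j) ∨ (1 ≤ k ∧ k < n ∧ l = j) := by omega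
  exact le_iSup_of_le k (le_iSup_of_le l (le_iSup_of_le h' le_rfl))

lemma measurable_past (hn : 1 ≤ n) (hnP : n ≤ P) (i : ℕ) :
    Measurable[past P X n (i + 1)] (X n i) := by
  refine Measurable.of_comap_le ?_
  have h' : (1 ≤ n ∧ n ≤ P ∧ i < i + 1) ∨ (1 ≤ n ∧ n < n ∧ i = i + 1) := by omega
  exact le_iSup_of_le n (le_iSup_of_le i (le_iSup_of_le h' le_rfl))

end Past

theorem statement19
    (dx : Measure E) [SigmaFinite dx] (P : ℕ) (hP : 1 ≤ P)
    (γ : (n : ℕ) → (Fin n → E) → ℝ≥0∞)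
    (hγ : ∀ n, 1 ≤ n → n ≤ P → Measurable (γ n))
    (hγfin : ∀ n, 1 ≤ n → n ≤ P → ∀ x, γ n x ≠ ⊤)
    (Z : ℕ → ℝ≥0∞)
    (hZ : ∀ n, 1 ≤ n → n ≤ P → Z n = ∫⁻ x, γ n x ∂(Measure.pi fun _ : Fin n => dx))
    (hZ0 : ∀ n, 1 ≤ n → n ≤ P → 0 < Z n) (hZt : ∀ n, 1 ≤ n → n ≤ P → Z n ≠ ⊤)
    (q1 : E → ℝ≥0∞) (hq1 : Measurable q1) (hq1pos : ∀ y, 0 < q1 y)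
    (hq1fin : ∀ y, q1 y ≠ ⊤) (hq1dens : ∫⁻ y, q1 y ∂dx = 1)
    (q : (m : ℕ) → (Fin m → E) → E → ℝ≥0∞)
    (hq : ∀ m, 1 ≤ m → m + 1 ≤ P → Measurable fun p : (Fin m → E) × E => q m p.1 p.2)
    (hqpos : ∀ m x y, 0 < q m x y) (hqfin : ∀ m x y, q m x y ≠ ⊤)
    (hqdens : ∀ m, 1 ≤ m → m + 1 ≤ P → ∀ x, ∫⁻ y, q m x y ∂dx = 1)
    (B : ℕ → ℝ≥0∞) (hBt : ∀ n, 1 ≤ n → n ≤ P → B n ≠ ⊤)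
    (hA11 : ∀ x : Fin 1 → E, 0 < γ 1 x / Z 1 → wgt1 γ q1 x ≤ B 1)
    (hA1 : ∀ m, 1 ≤ m → m + 1 ≤ P → ∀ x : Fin (m + 1) → E,
      0 < γ (m + 1) x / Z (m + 1) → wgt γ q m x ≤ B (m + 1))
    (hδ : ∀ m, 1 ≤ m → m + 1 ≤ P → ∃ δ : ℝ≥0∞, 0 < δ ∧
      ∀ x : Fin m → E, 0 < γ m x / Z m → δ ≤ ratio dx γ Z m x)
    {Ω : Type*} [MeasurableSpace Ω] (μ : Measure Ω) [IsProbabilityMeasure μ]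
    (X : (n : ℕ) → ℕ → Ω → (Fin n → E)) (x0 : (n : ℕ) → Fin n → E)
    (hXmeas : ∀ k i, 1 ≤ k → k ≤ P → Measurable (X k i))
    (hx0 : ∀ k, 1 ≤ k → k ≤ P → 0 < γ k (x0 k) / Z k)
    (hinit : ∀ k, 1 ≤ k → k ≤ P → ∀ ω, X k 0 ω = x0 k)
    (hc1 : ∀ i, 1 ≤ i → ∀ g : (Fin 1 → E) → ℝ, Measurable g → (∀ z, |g z| ≤ 1) →
      (μ[(fun ω => g (X 1 i ω))|past P X 1 i]) =ᵐ[μ]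
        fun ω => ∫ z, g z ∂(ker1 dx γ q1 (X 1 (i - 1) ω)))
    (hcn : ∀ m, 1 ≤ m → m + 1 ≤ P → ∀ i, 1 ≤ i → ∀ g : (Fin (m + 1) → E) → ℝ,
      Measurable g → (∀ z, |g z| ≤ 1) →
      (μ[(fun ω => g (X (m + 1) i ω))|past P X (m + 1) i]) =ᵐ[μ]
        fun ω => ∫ z, g z ∂(kerM dx γ q m (emp X m i ω) (X (m + 1) (i - 1) ω))) :
    ∀ n, 1 ≤ n → n ≤ P → ∀ f : (Fin n → E) → ℝ, Measurable f → (∀ z, |f z| ≤ 1) →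
      Filter.Tendsto (fun i => ∫ ω, f (X n i ω) ∂μ) Filter.atTop
        (nhds (∫ z, f z ∂(tgt dx γ Z n))) := by
  suffices main : ∀ n, 1 ≤ n → n ≤ P → ∀ f : (Fin n → E) → ℝ, Measurable f → (∀ z, |f z| ≤ 1) →
      Filter.Tendsto (fun k : ℕ => ∫ ω, |((k : ℝ) + 1)⁻¹ * ∑ i ∈ Finset.range (k + 1), f (X n i ω)
        - ∫ z, f z ∂(tgt dx γ Z n)| ∂μ) Filter.atTop (nhds 0) ∧
      Filter.Tendsto (fun i => ∫ ω, f (X n i ω) ∂μ) Filter.atTop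
        (nhds (∫ z, f z ∂(tgt dx γ Z n))) from
    fun n h1 hn f hfm hf => (main n h1 hn f hfm hf).2
  intro n h1
  induction n, h1 using Nat.le_induction with
  | base =>
    intro h1P f hfm hf
    have := isProbabilityMeasure_tgt (hγ 1 le_rfl h1P) (hZ 1 le_rfl h1P) (hZ0 1 le_rfl h1P)
      (hZt 1 le_rfl h1P)
    have := isProbabilityMeasure_prop1 hq1dens
    have hwB : ∀ x, wgt1 γ q1 x ≤ B 1 := fun x => by
      rcases eq_or_ne (γ 1 x) 0 with h | h
      · simp [wgt1, h]
      · exact hA11 x (ENNReal.div_pos h (hZt 1 le_rfl h1P))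
    exact adaptiveSampler_ergodic (measurable_wgt1 (hγ 1 le_rfl h1P) hq1) (hBt 1 le_rfl h1P) hwB
      (hZ0 1 le_rfl h1P).ne' (hZt 1 le_rfl h1P)
      (prop1_withDensity_wgt1 (hγ 1 le_rfl h1P) hq1 hq1pos hq1fin (hZ0 1 le_rfl h1P).ne'
        (hZt 1 le_rfl h1P))
      (past_le hXmeas h1P) (past_mono h1P) (measurable_past le_rfl h1P)
      (Q' := fun _ _ => prop1 dx q1) (fun _ _ => this)
      (fun i g hgm hg => hc1 (i + 1) (Nat.le_add_left 1 i) g hgm hg)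
      (fun φ _ _ i => by simp) (fun φ _ _ => by simp) hfm hf
  | succ m h1m ih =>
    intro hmP f hfm hf
    have hm : m ≤ P := by omega
    have h1m' : 1 ≤ m + 1 := by omega
    have hqm := hq m h1m hmP
    have hd := hqdens m h1m hmP
    have := isProbabilityMeasure_tgt (hγ m h1m hm) (hZ m h1m hm) (hZ0 m h1m hm) (hZt m h1m hm)
    have := isProbabilityMeasure_tgt (hγ _ h1m' hmP) (hZ _ h1m' hmP) (hZ0 _ h1m' hmP)
      (hZt _ h1m' hmP)
    have := isProbabilityMeasure_propM hqm hd (tgt dx γ Z m)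
    have hwB : ∀ x, wgt γ q m x ≤ B (m + 1) := fun x => by
      rcases eq_or_ne (γ (m + 1) x) 0 with h | h
      · simp [wgt, h]
      · exact hA1 m h1m hmP x (ENNReal.div_pos h (hZt _ h1m' hmP))
    have hemp : ∀ φ : (Fin (m + 1) → E) → ℝ, Measurable φ → (∀ z, |φ z| ≤ 1) → ∀ i ω,
        |∫ z, φ z ∂(propM dx q m (emp X m i ω)) - ∫ z, φ z ∂(propM dx q m (tgt dx γ Z m))|
          = |((i : ℝ) + 1)⁻¹ * ∑ k ∈ Finset.range (i + 1), propT dx q m φ (X m k ω)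
            - ∫ z, propT dx q m φ z ∂(tgt dx γ Z m)| := fun φ hφm hφ i ω => by
      have := isProbabilityMeasure_emp X m i ω
      rw [integral_propM hqm (hqfin m) hd _ hφm hφ, integral_propM hqm (hqfin m) hd _ hφm hφ,
        integral_emp X m i ω (measurable_propT hqm hφm) (abs_propT_le hqm hd hφ)]
    refine adaptiveSampler_ergodic (measurable_wgt (hγ m h1m hm) (hγ _ h1m' hmP) hqm)
      (hBt _ h1m' hmP) hwB (ENNReal.div_pos (hZ0 _ h1m' hmP).ne' (hZt m h1m hm)).ne'
      (ENNReal.div_ne_top (hZt _ h1m' hmP) (hZ0 m h1m hm).ne')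
      (propM_withDensity_wgt (hγ m h1m hm) (hγ _ h1m' hmP) (hγfin m h1m hm) hqm (hqpos m)
        (hqfin m) (hBt _ h1m' hmP) hwB (hZ0 _ h1m' hmP).ne' (hZt _ h1m' hmP))
      (past_le hXmeas hmP) (past_mono hmP) (measurable_past h1m' hmP)
      (Q' := fun i ω => propM dx q m (emp X m i ω)) (fun i ω => ?_)
      (fun i g hgm hg => hcn m h1m hmP (i + 1) (Nat.le_add_left 1 i) g hgm hg)
      (fun φ hφm hφ i => ?_) (fun φ hφm hφ => ?_) hfm hf
    · have := isProbabilityMeasure_emp X m i ω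
      exact isProbabilityMeasure_propM hqm hd _
    · simp only [hemp φ hφm hφ]
      have hTm := measurable_propT (dx := dx) hqm hφm
      exact (((integrable_finsetSum _ fun k _ => integrable_of_abs_le
        (hTm.comp (hXmeas m k h1m hm)) fun ω => abs_propT_le hqm hd hφ _).const_mul _).sub
        (integrable_const _)).abs
    · simp only [hemp φ hφm hφ]
      exact (ih hm _ (measurable_propT hqm hφm) (abs_propT_le hqm hd hφ)).1

end

end Paper
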